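/- Let J be an m × n real matrix, let H = [[0, Jᵀ],[J, 0]] be the augmented symmetric matrix, and let φ be a no-zig-zag coloring of the adjacency graph of H, assigning a color φ(col j) to each column vertex and φ(row i) to each row vertex. Then every nonzero entry of J is directly recoverable from one of the two compressed matrices: for every (i,j) with J_ij ≠ 0, either φ(col j) > 0 and j is the only column index k with φ(col k) = φ(col j) and J_ik ≠ 0, or φ(row i) > 0 and i is the only row index r with φ(row r) = φ(row i) and J_rj ≠ 0. -/

import Mathlib

/-- `u` and `v` are adjacent in the adjacency graph of a symmetric matrix `H`
with zero diagonal. -/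
def IsEdge {ι : Type*} (H : Matrix ι ι ℝ) (u v : ι) : Prop :=
  u ≠ v ∧ H u v ≠ 0

/-- `φ` is a no-zig-zag coloring of the adjacency graph of `H`, with `0` the
neutral color. -/
def NoZigZag {ι : Type*} (H : Matrix ι ι ℝ) (φ : ι → ℕ) : Prop :=
  (∀ u v : ι, IsEdge H u v → 0 < φ u ∨ 0 < φ v) ∧
  (∀ w u v : ι, φ w = 0 → u ≠ v → IsEdge H w u → IsEdge H w v → φ u ≠ φ v) ∧
  (∀ q i j p : ι, q ≠ i → q ≠ j → q ≠ p → i ≠ j → i ≠ p → j ≠ p →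
    IsEdge H q i → IsEdge H i j → IsEdge H j p → φ q ≠ φ j ∨ φ i ≠ φ p)

theorem bicoloring_direct_recovery {m n : ℕ} (J : Matrix (Fin m) (Fin n) ℝ)
    (φ : Fin n ⊕ Fin m → ℕ)
    (hφ : NoZigZag (Matrix.fromBlocks 0 J.transpose J 0) φ) :
    ∀ i : Fin m, ∀ j : Fin n, J i j ≠ 0 →
      (0 < φ (Sum.inl j) ∧
        ∀ k : Fin n, φ (Sum.inl k) = φ (Sum.inl j) → J i k ≠ 0 → k = j) ∨
      (0 < φ (Sum.inr i) ∧
        ∀ r : Fin m, φ (Sum.inr r) = φ (Sum.inr i) → J r j ≠ 0 → r = i) := by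
  intro i j hij
  obtain ⟨h_edge, h_neutral, h_path⟩ := hφ
  have row_col : ∀ r k, J r k ≠ 0 →
      IsEdge (Matrix.fromBlocks 0 J.transpose J 0) (Sum.inr r) (Sum.inl k) :=
    fun r k h => ⟨by simp, by simpa using h⟩
  have col_row : ∀ r k, J r k ≠ 0 →
      IsEdge (Matrix.fromBlocks 0 J.transpose J 0) (Sum.inl k) (Sum.inr r) :=
    fun r k h => ⟨by simp, by simpa using h⟩
  rcases Nat.eq_zero_or_pos (φ (Sum.inl j)) with hj | hj
  · refine Or.inr ⟨(h_edge _ _ (col_row i j hij)).resolve_left (by omega), ?_⟩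
    intro r hr hrj
    by_contra hne
    exact h_neutral _ _ _ hj (by simpa using hne) (col_row r j hrj) (col_row i j hij) hr
  rcases Nat.eq_zero_or_pos (φ (Sum.inr i)) with hi | hi
  · refine Or.inl ⟨hj, ?_⟩
    intro k hk hik
    by_contra hne
    exact h_neutral _ _ _ hi (by simpa using hne) (row_col i k hik) (row_col i j hij) hk
  by_contra! hcon
  obtain ⟨k, hk, hik, hkj⟩ := hcon.1 hj
  obtain ⟨r, hr, hrj, hri⟩ := hcon.2 hi
  rcases h_path (Sum.inl k) (Sum.inr i) (Sum.inl j) (Sum.inr r) (by simp)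
    (by simpa using hkj) (by simp) (by simp) (by simpa using hri.symm) (by simp)
    (col_row i k hik) (row_col i j hij) (col_row r j hrj) with h | h
  · exact h hk
  · exact h hr.symm
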